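/- Let A ⊆ ℕ with 0 ∈ A and gcd(A) = 1 (the greatest common divisor of all elements of A is 1). The following are equivalent: (1) A is a saturated numerical semigroup; (2) a + d_A(a) ∈ A for all a ∈ A\{0}; (3) a + k·d_A(a) ∈ A for all a ∈ A\{0} and all k ∈ ℕ. -/

import Mathlib

/-- A numerical semigroup: subset of ℕ containing 0, closed under addition,
with finite complement. -/
def IsNumericalSemigroup (S : Set ℕ) : Prop :=
  0 ∈ S ∧ (∀ a ∈ S, ∀ b ∈ S, a + b ∈ S) ∧ Sᶜ.Finite

/-- `dOf S s = gcd {x ∈ S : x ≤ s}`. -/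
noncomputable def dOf (S : Set ℕ) (s : ℕ) : ℕ :=
  letI := Classical.decPred (· ∈ S)
  ((Finset.range (s + 1)).filter (· ∈ S)).gcd id

/-- A saturated numerical semigroup. -/
def IsSaturatedNS (S : Set ℕ) : Prop :=
  IsNumericalSemigroup S ∧ ∀ s ∈ S, s ≠ 0 → s + dOf S s ∈ S

/-- `Sat F`: saturated numerical semigroups with Frobenius number `F`. -/
def SatF (F : ℕ) : Set (Set ℕ) :=
  {S | IsSaturatedNS S ∧ F ∉ S ∧ ∀ x, x ∉ S → x ≤ F}

/-- Multiplicity: least nonzero element. -/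
noncomputable def multOf (S : Set ℕ) : ℕ := sInf {x | x ∈ S ∧ x ≠ 0}

/-- Pseudo-Frobenius numbers. -/
def PFset (S : Set ℕ) : Set ℕ := {z | z ∉ S ∧ ∀ s ∈ S, s ≠ 0 → z + s ∈ S}

/-- Special gaps. -/
def SGset (S : Set ℕ) : Set ℕ := {x | x ∈ PFset S ∧ 2 * x ∈ S}

/-- `TSet a b = ⟨a⟩ ∪ {x : x ≥ b}`. -/
def TSet (a b : ℕ) : Set ℕ := {x | a ∣ x} ∪ {x | b ≤ x}

/-- A `Sat(F)`-set. -/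
def SatFSet (F : ℕ) (X : Set ℕ) : Prop :=
  X ∩ ({0} ∪ {x | F + 1 ≤ x}) = ∅ ∧ ∃ S ∈ SatF F, X ⊆ S

/-- `Sat(F)[X]`: intersection of all elements of `Sat F` containing `X`. -/
def SatClosure (F : ℕ) (X : Set ℕ) : Set ℕ := ⋂₀ {S | S ∈ SatF F ∧ X ⊆ S}

/-- `X` is a minimal `Sat(F)`-system of generators of `S`. -/
def IsMinSatGen (F : ℕ) (X S : Set ℕ) : Prop :=
  SatFSet F X ∧ SatClosure F X = S ∧ ∀ Y : Set ℕ, Y ⊂ X → SatClosure F Y ≠ S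

/-- The `Sat(F)`-rank of `S`: minimal cardinality of a `Sat(F)`-set `X`
with `Sat(F)[X] = S`. -/
noncomputable def SatRank (F : ℕ) (S : Set ℕ) : ℕ :=
  sInf {k | ∃ X : Set ℕ, SatFSet F X ∧ SatClosure F X = S ∧ X.ncard = k}

theorem dOf_dvd {A : Set ℕ} {a x : ℕ} (hx : x ∈ A) (hxa : x ≤ a) : dOf A a ∣ x := by
  classical
  unfold dOf
  exact Finset.gcd_dvd (f := id) (by simp [hx]; omega)

theorem dvd_dOf {A : Set ℕ} {a d : ℕ} (h : ∀ x ∈ A, x ≤ a → d ∣ x) : d ∣ dOf A a := by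
  classical
  unfold dOf
  refine Finset.dvd_gcd fun x hx => ?_
  simp only [Finset.mem_filter, Finset.mem_range] at hx
  exact h x hx.2 (by omega)

theorem dOf_dvd_dOf (A : Set ℕ) {a b : ℕ} (hab : a ≤ b) : dOf A b ∣ dOf A a :=
  dvd_dOf fun _ hx hxa => dOf_dvd hx (hxa.trans hab)

theorem dOf_pos {A : Set ℕ} {a : ℕ} (ha : a ∈ A) (ha0 : a ≠ 0) : 0 < dOf A a :=
  Nat.pos_of_dvd_of_pos (dOf_dvd ha le_rfl) (Nat.pos_of_ne_zero ha0)

/-- A set closed under `a ↦ a + dOf A a` is closed under adding to `a` any multiple of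
`dOf A a`. -/
theorem add_mem_of_dOf_dvd {A : Set ℕ} (h : ∀ a ∈ A, a ≠ 0 → a + dOf A a ∈ A) {a n : ℕ}
    (ha : a ∈ A) (ha0 : a ≠ 0) (hn : dOf A a ∣ n) : a + n ∈ A := by
  induction n using Nat.strong_induction_on generalizing a with
  | _ n ih =>
    rcases Nat.eq_zero_or_pos n with rfl | hpos
    · exact ha
    · have hd := dOf_pos ha ha0
      have hle := Nat.le_of_dvd hpos hn
      have key := ih (n - dOf A a) (by omega) (h a ha ha0) (by omega)
        ((dOf_dvd_dOf A (Nat.le_add_right _ _)).trans (Nat.dvd_sub hn dvd_rfl))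
      rwa [show a + dOf A a + (n - dOf A a) = a + n by omega] at key

theorem exists_dOf_eq_one {A : Set ℕ} (hgcd : ∀ d : ℕ, (∀ a ∈ A, d ∣ a) → d ∣ 1) :
    ∃ a ∈ A, a ≠ 0 ∧ dOf A a = 1 := by
  have hne : {a | a ∈ A ∧ a ≠ 0}.Nonempty := by
    by_contra hempty
    have h2 : 2 ∣ 1 := hgcd 2 fun a ha => by
      by_cases ha0 : a = 0
      · simp [ha0]
      · exact absurd ⟨a, ha, ha0⟩ hempty
    omega
  obtain ⟨a, ⟨ha, ha0⟩, hmin⟩ := exists_minimalFor_of_wellFoundedLT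
    (fun a => a ∈ A ∧ a ≠ 0) (dOf A) hne
  refine ⟨a, ha, ha0, Nat.dvd_one.mp (hgcd _ fun x hx => ?_)⟩
  rcases le_total x a with hxa | hax
  · exact dOf_dvd hx hxa
  · have hle := Nat.le_of_dvd (dOf_pos ha ha0) (dOf_dvd_dOf A hax)
    exact (le_antisymm hle (hmin ⟨hx, by omega⟩ hle)) ▸ dOf_dvd hx le_rfl

theorem isNumericalSemigroup_of_add_dOf_mem {A : Set ℕ} (h0 : 0 ∈ A)
    (hgcd : ∀ d : ℕ, (∀ a ∈ A, d ∣ a) → d ∣ 1) (h : ∀ a ∈ A, a ≠ 0 → a + dOf A a ∈ A) :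
    IsNumericalSemigroup A := by
  have hadd : ∀ a ∈ A, ∀ b ∈ A, a ≤ b → b + a ∈ A := fun a ha b hb hab => by
    by_cases hb0 : b = 0
    · rwa [hb0, zero_add]
    · exact add_mem_of_dOf_dvd h hb hb0 (dOf_dvd ha hab)
  refine ⟨h0, fun a ha b hb => ?_, ?_⟩
  · rcases le_total a b with hab | hba
    · rw [add_comm]
      exact hadd a ha b hb hab
    · exact hadd b hb a ha hba
  · obtain ⟨a, ha, ha0, ha1⟩ := exists_dOf_eq_one hgcd
    refine (Set.finite_Iio a).subset fun x hx => ?_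
    by_contra hxa
    have hax : a ≤ x := not_lt.mp hxa
    refine hx ?_
    rw [← Nat.add_sub_cancel' hax]
    exact add_mem_of_dOf_dvd h ha ha0 (by simp [ha1])

/-- characterizations of saturated numerical semigroups among
subsets `A ⊆ ℕ` with `0 ∈ A` and `gcd(A) = 1`. -/
theorem saturated_tfae (A : Set ℕ) (h0 : 0 ∈ A)
    (hgcd : ∀ d : ℕ, (∀ a ∈ A, d ∣ a) → d ∣ 1) :
    List.TFAE
      [IsSaturatedNS A,
       ∀ a ∈ A, a ≠ 0 → a + dOf A a ∈ A,
       ∀ a ∈ A, a ≠ 0 → ∀ k : ℕ, a + k * dOf A a ∈ A] := by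
  tfae_have 1 → 2 := fun h => h.2
  tfae_have 2 → 3 := fun h a ha ha0 k => add_mem_of_dOf_dvd h ha ha0 (Dvd.intro_left k rfl)
  tfae_have 3 → 2 := fun h a ha ha0 => by simpa using h a ha ha0 1
  tfae_have 2 → 1 := fun h => ⟨isNumericalSemigroup_of_add_dOf_mem h0 hgcd h, h⟩
  tfae_finish
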